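/- (Max–min guarantee of Gradient Greedy, Theorem 8.) In addition to the setting of the Gradient Greedy convergence theorem—X ⊆ ℝ^d nonempty closed convex with x₁ ∈ X and ‖x − x₁‖² ≤ H on X; f : ℝ^d × 2^V → [0, ∞) with each f(·, S) convex differentiable, ‖∇ₓ f(x, S)‖ ≤ M, ∇ₓ f(·, S) L-Lipschitz; √T ≥ L, γ = 1/√T; for all 1 ≤ t ≤ T: |S_t| ≤ k, (1 − 1/e)·f(x_t, S) ≤ f(x_t, S_t) for all |S| ≤ k, and x_{t+1} = π_X(x_t − γ ∇ₓ f(x_t, S_t))—assume moreover that f(x, ·) is monotone for every x, i.e. f(x, S) ≤ f(x, T') whenever S ⊆ T' ⊆ V. Then (1 − 1/e) · max_{|S| ≤ k} min_{x ∈ X} f(x, S) ≤ min_{x ∈ X} f(x, S₁ ∪ S₂ ∪ ⋯ ∪ S_T) + (2M² + H/2)/√T. -/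

import Mathlib

open scoped RealInnerProductSpace

/-- `maxCard k g` is the maximum of `g S` over all `S ⊆ V` with `|S| ≤ k`. -/
noncomputable def maxCard {V : Type} [Fintype V] [DecidableEq V] (k : ℕ)
    (g : Finset V → ℝ) : ℝ :=
  ((Finset.univ : Finset (Finset V)).filter (fun S => S.card ≤ k)).sup'
    ⟨∅, by simp⟩ g

/-- First-order characterization of convexity: a convex function lies above its tangent planes. -/
theorem ConvexOn.add_inner_gradient_le {E : Type*} [NormedAddCommGroup E] [InnerProductSpace ℝ E]
    [CompleteSpace E] {φ : E → ℝ} {g a : E} (hφ : ConvexOn ℝ Set.univ φ)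
    (hg : HasGradientAt φ g a) (b : E) : φ a + ⟪g, b - a⟫ ≤ φ b := by
  have hline : ConvexOn ℝ Set.univ (φ ∘ AffineMap.lineMap (k := ℝ) a b) :=
    hφ.comp_affineMap (AffineMap.lineMap a b)
  have hderiv : HasDerivAt (φ ∘ AffineMap.lineMap (k := ℝ) a b) ⟪g, b - a⟫ 0 := by
    have hf : HasFDerivAt φ (InnerProductSpace.toDual ℝ E g) (AffineMap.lineMap a b (0 : ℝ)) := by
      simpa using hg.hasFDerivAt
    simpa using hf.comp_hasDerivAt (0 : ℝ) AffineMap.hasDerivAt_lineMap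
  have h := hline.le_slope_of_hasDerivAt (Set.mem_univ 0) (Set.mem_univ 1) one_pos hderiv
  simp [slope_def_field] at h
  linarith

/-- One step of projected gradient descent, with `p` the projection of `a - γ • g` and `z` a
competitor. -/
theorem two_mul_inner_le_of_projected_step {E : Type*} [NormedAddCommGroup E]
    [InnerProductSpace ℝ E] {γ : ℝ} {a g p z : E} (h : ⟪(a - γ • g) - p, z - p⟫ ≤ 0) :
    2 * γ * ⟪g, a - z⟫ ≤ ‖a - z‖ ^ 2 - ‖p - z‖ ^ 2 + γ ^ 2 * ‖g‖ ^ 2 := by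
  have hstep : ‖a - γ • g - z‖ ^ 2 = ‖a - z‖ ^ 2 - 2 * γ * ⟪g, a - z⟫ + γ ^ 2 * ‖g‖ ^ 2 := by
    rw [sub_right_comm, norm_sub_sq_real, inner_smul_right, norm_smul, mul_pow,
      Real.norm_eq_abs, sq_abs, real_inner_comm]
    ring
  have hsplit : ‖a - γ • g - z‖ ^ 2
      = ‖a - γ • g - p‖ ^ 2 - 2 * ⟪(a - γ • g) - p, z - p⟫ + ‖p - z‖ ^ 2 := by
    rw [← sub_sub_sub_cancel_right (a - γ • g) z p, norm_sub_sq_real, norm_sub_rev z p]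
  nlinarith [sq_nonneg ‖a - γ • g - p‖]

/-- Regret bound of projected gradient descent with constant step size. -/
theorem two_mul_sum_inner_le_of_projected_steps {E : Type*} [NormedAddCommGroup E]
    [InnerProductSpace ℝ E] {γ M : ℝ} {T : ℕ} {x g : ℕ → E} {z : E}
    (hM : ∀ t ∈ Finset.Icc 1 T, ‖g t‖ ≤ M)
    (h : ∀ t ∈ Finset.Icc 1 T, ⟪(x t - γ • g t) - x (t + 1), z - x (t + 1)⟫ ≤ 0) :
    2 * γ * ∑ t ∈ Finset.Icc 1 T, ⟪g t, x t - z⟫ ≤ ‖x 1 - z‖ ^ 2 + T * (γ ^ 2 * M ^ 2) := by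
  suffices 2 * γ * ∑ t ∈ Finset.Icc 1 T, ⟪g t, x t - z⟫
      ≤ ‖x 1 - z‖ ^ 2 - ‖x (T + 1) - z‖ ^ 2 + T * (γ ^ 2 * M ^ 2) by
    linarith [sq_nonneg ‖x (T + 1) - z‖]
  induction T with
  | zero => simp
  | succ n ih =>
    have hsub : Finset.Icc 1 n ⊆ Finset.Icc 1 (n + 1) := Finset.Icc_subset_Icc_right n.le_succ
    have hprev := ih (fun t ht => hM t (hsub ht)) (fun t ht => h t (hsub ht))
    have hlast : n + 1 ∈ Finset.Icc 1 (n + 1) := by simp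
    have hstep := two_mul_inner_le_of_projected_step (h _ hlast)
    have hnorm : γ ^ 2 * ‖g (n + 1)‖ ^ 2 ≤ γ ^ 2 * M ^ 2 := by
      gcongr
      exact hM _ hlast
    rw [Finset.sum_Icc_succ_top (by omega), mul_add]
    push_cast
    linarith

/-- (Max–min guarantee of Gradient Greedy.) In the setting
of the Gradient Greedy convergence theorem, and assuming moreover that
`f(x,·)` is monotone for every `x`, the union `S₁ ∪ ⋯ ∪ S_T` satisfies
`(1 − 1/e)·max_{|S|≤k} min_{x∈X} f(x,S) ≤ min_{x∈X} f(x, S₁ ∪ ⋯ ∪ S_T)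
  + (2M² + H/2)/√T`. -/
theorem gradient_greedy_maxmin_guarantee
    {d : ℕ} (V : Type) [Fintype V] [DecidableEq V] (k : ℕ) (hk : 0 < k)
    (X : Set (EuclideanSpace ℝ (Fin d))) (hXne : X.Nonempty)
    (hXcl : IsClosed X) (hXconv : Convex ℝ X)
    (H M L : ℝ) (hH : 0 < H)
    (f : EuclideanSpace ℝ (Fin d) → Finset V → ℝ)
    (gradf : EuclideanSpace ℝ (Fin d) → Finset V → EuclideanSpace ℝ (Fin d))
    (hf_nonneg : ∀ x S, 0 ≤ f x S)
    (hconv : ∀ S : Finset V, S.card ≤ k → ConvexOn ℝ Set.univ (fun x => f x S))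
    (hgrad : ∀ S : Finset V, S.card ≤ k →
      ∀ x, HasGradientAt (fun y => f y S) (gradf x S) x)
    (hM : ∀ x, ∀ S : Finset V, S.card ≤ k → ‖gradf x S‖ ≤ M)
    (hL : ∀ S : Finset V, S.card ≤ k →
      ∀ x x', ‖gradf x' S - gradf x S‖ ≤ L * ‖x' - x‖)
    (hfmono : ∀ x, ∀ S T' : Finset V, S ⊆ T' → f x S ≤ f x T')
    (T : ℕ) (hT : 0 < T) (hTL : L ≤ Real.sqrt T)
    (γ : ℝ) (hγ : γ = 1 / Real.sqrt T)
    (x : ℕ → EuclideanSpace ℝ (Fin d)) (S : ℕ → Finset V)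
    (hx1 : x 1 ∈ X)
    (hbound : ∀ z ∈ X, ‖z - x 1‖ ^ 2 ≤ H)
    (hcard : ∀ t, 1 ≤ t → t ≤ T → (S t).card ≤ k)
    (hgreedy : ∀ t, 1 ≤ t → t ≤ T → ∀ S' : Finset V, S'.card ≤ k →
      (1 - 1 / Real.exp 1) * f (x t) S' ≤ f (x t) (S t))
    (hproj_mem : ∀ t, 1 ≤ t → t ≤ T → x (t + 1) ∈ X)
    (hproj : ∀ t, 1 ≤ t → t ≤ T → ∀ w ∈ X,
      ⟪(x t - γ • gradf (x t) (S t)) - x (t + 1), w - x (t + 1)⟫ ≤ 0) :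
    (1 - 1 / Real.exp 1) * maxCard k (fun S' => sInf ((fun z => f z S') '' X)) ≤
      sInf ((fun z => f z ((Finset.Icc 1 T).biUnion S)) '' X)
        + (2 * M ^ 2 + H / 2) / Real.sqrt T := by
  obtain ⟨S', hS', hmax⟩ := Finset.exists_mem_eq_sup'
    (s := (Finset.univ : Finset (Finset V)).filter (fun S => S.card ≤ k)) ⟨∅, by simp⟩
    (fun S' => sInf ((fun z => f z S') '' X))
  replace hS' : S'.card ≤ k := by simpa using hS'
  rw [maxCard, hmax, ← sub_le_iff_le_add]
  refine le_csInf (hXne.image _) ?_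
  rintro _ ⟨z, hz, rfl⟩
  set U := (Finset.Icc 1 T).biUnion S
  set c := (1 - 1 / Real.exp 1) * sInf ((fun z => f z S') '' X)
  have hmem : ∀ t ∈ Finset.Icc 1 T, x t ∈ X := by
    intro t ht
    rw [Finset.mem_Icc] at ht
    obtain ⟨n, rfl⟩ := Nat.exists_eq_add_of_le' ht.1
    rcases n.eq_zero_or_pos with rfl | hn
    · exact hx1
    · exact hproj_mem n hn (by omega)
  have hone : (0 : ℝ) ≤ 1 - 1 / Real.exp 1 := by
    rw [sub_nonneg, div_le_one (Real.exp_pos 1)]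
    exact Real.one_le_exp zero_le_one
  have hround : ∀ t ∈ Finset.Icc 1 T, c - f z U ≤ ⟪gradf (x t) (S t), x t - z⟫ := by
    intro t ht
    obtain ⟨h1, hT'⟩ := Finset.mem_Icc.mp ht
    have hinf : sInf ((fun z => f z S') '' X) ≤ f (x t) S' :=
      csInf_le ⟨0, by rintro _ ⟨w, -, rfl⟩; exact hf_nonneg w S'⟩ ⟨x t, hmem t ht, rfl⟩
    have hc : c ≤ f (x t) (S t) :=
      (mul_le_mul_of_nonneg_left hinf hone).trans (hgreedy t h1 hT' S' hS')
    have htangent := (hconv _ (hcard t h1 hT')).add_inner_gradient_le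
      (hgrad _ (hcard t h1 hT') (x t)) z
    have hU : f z (S t) ≤ f z U := hfmono z _ _ (Finset.subset_biUnion_of_mem S ht)
    rw [← neg_sub z (x t), inner_neg_right]
    linarith
  have hsum := Finset.sum_le_sum hround
  have hregret := two_mul_sum_inner_le_of_projected_steps (γ := γ) (M := M) (T := T) (x := x)
    (g := fun t => gradf (x t) (S t)) (z := z)
    (fun t ht => hM _ _ (hcard t (Finset.mem_Icc.mp ht).1 (Finset.mem_Icc.mp ht).2))
    (fun t ht => hproj t (Finset.mem_Icc.mp ht).1 (Finset.mem_Icc.mp ht).2 z hz)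
  have hz1 := hbound z hz
  rw [norm_sub_rev] at hz1
  simp only [Finset.sum_const, Nat.card_Icc, Nat.add_sub_cancel, nsmul_eq_mul] at hsum
  have hs : 0 < Real.sqrt T := Real.sqrt_pos.mpr (Nat.cast_pos.mpr hT)
  have hTs : (T : ℝ) = Real.sqrt T ^ 2 := (Real.sq_sqrt T.cast_nonneg).symm
  set s := Real.sqrt T
  rw [hTs] at hsum hregret
  have hγ0 : 0 < γ := hγ ▸ one_div_pos.mpr hs
  have hγs : γ * s = 1 := by rw [hγ]; exact one_div_mul_cancel hs.ne'
  have hscaled : 2 * s * (c - f z U) ≤ H + M ^ 2 := by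
    have hmul := mul_le_mul_of_nonneg_left hsum (by positivity : 0 ≤ 2 * γ)
    have hleft : 2 * γ * (s ^ 2 * (c - f z U)) = 2 * s * (c - f z U) := by
      linear_combination 2 * s * (c - f z U) * hγs
    have hright : s ^ 2 * (γ ^ 2 * M ^ 2) = M ^ 2 := by
      linear_combination M ^ 2 * (γ * s + 1) * hγs
    linarith
  rw [sub_le_comm, le_div_iff₀ hs]
  nlinarith [sq_nonneg M]
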